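/- The following numerical bounds hold: ĝ_0(0) > 0.65 and ĝ_1(1) > 0.8. -/

import Mathlib

open MeasureTheory Real Set FourierTransform Filter Topology

/-- The auxiliary function `g_τ`, supported on `[-1,1]`, with
`g_τ(x) = 2(1-|x|)(cos(2πτx) - cos(2π(τ+1)x))/(4π²x²)` for `0 < |x| ≤ 1` and the
continuous extension `g_τ(0) = 2τ + 1`. -/
noncomputable def gfun (τ : ℝ) (x : ℝ) : ℝ :=
  if x = 0 then 2 * τ + 1
  else if |x| ≤ 1 then
    2 * (1 - |x|) * (Real.cos (2 * π * τ * x) - Real.cos (2 * π * (τ + 1) * x)) /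
      (4 * π ^ 2 * x ^ 2)
  else 0

/-- The Fourier transform `ĝ_τ(t) = ∫_{-1}^{1} g_τ(x) e^{-2πixt} dx`.  Since `g_τ` is
real-valued, even and supported in `[-1,1]`, this equals the real-valued cosine
integral `∫ g_τ(x) cos(2πxt) dx` over `ℝ`, which we take as the definition. -/
noncomputable def ghat (τ : ℝ) (t : ℝ) : ℝ :=
  ∫ x : ℝ, gfun τ x * Real.cos (2 * π * x * t)

/-- The real part of the truncated exponential series at `y * I` is the truncated cosine series. -/
lemma re_sum_range_mul_I_pow_div_factorial (y : ℝ) (M : ℕ) :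
    (∑ m ∈ Finset.range (2 * M + 2), ((y : ℂ) * Complex.I) ^ m / (m.factorial : ℂ)).re =
      1 - ∑ j ∈ Finset.range M, (-1) ^ j * y ^ (2 * j + 2) / ((2 * j + 2).factorial : ℝ) := by
  induction M with
  | zero => simp [Finset.sum_range_succ]
  | succ k ih =>
    have hev : ((y : ℂ) * Complex.I) ^ (2 * k + 2) / ((2 * k + 2).factorial : ℂ) =
        ((-((-1) ^ k * y ^ (2 * k + 2) / ((2 * k + 2).factorial : ℝ)) : ℝ) : ℂ) := by
      rw [mul_pow, show 2 * k + 2 = 2 * (k + 1) by ring, pow_mul Complex.I, Complex.I_sq]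
      push_cast
      ring
    have hodd : ((y : ℂ) * Complex.I) ^ (2 * k + 3) / ((2 * k + 3).factorial : ℂ) =
        (((-1) ^ (k + 1) * y ^ (2 * k + 3) / ((2 * k + 3).factorial : ℝ) : ℝ) : ℂ) *
          Complex.I := by
      rw [mul_pow, show 2 * k + 3 = 2 * (k + 1) + 1 by ring, pow_succ Complex.I, pow_mul Complex.I,
        Complex.I_sq]
      push_cast
      ring
    rw [show 2 * (k + 1) + 2 = 2 * k + 2 + 1 + 1 by ring, Finset.sum_range_succ _ (2 * k + 2 + 1),
      Finset.sum_range_succ _ (2 * k + 2), Finset.sum_range_succ _ k, hev, hodd, Complex.add_re,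
      Complex.add_re, ih, Complex.re_ofReal_mul, Complex.ofReal_re, Complex.I_re]
    ring

/-- Taylor expansion of `1 - cos y` with an explicit remainder. -/
lemma abs_one_sub_cos_sub_sum_le {y : ℝ} {M : ℕ} (hy : |y| ≤ M) :
    |1 - Real.cos y -
        ∑ j ∈ Finset.range M, (-1) ^ j * y ^ (2 * j + 2) / ((2 * j + 2).factorial : ℝ)| ≤
      2 * y ^ (2 * M + 2) / ((2 * M + 2).factorial : ℝ) := by
  have hn : ‖(y : ℂ) * Complex.I‖ = |y| := by simp
  have h := Complex.exp_bound' (x := (y : ℂ) * Complex.I) (n := 2 * M + 2) (by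
    rw [hn, div_le_iff₀ (by positivity)]
    push_cast
    linarith)
  have h' := (Complex.abs_re_le_norm _).trans h
  rw [Complex.sub_re, re_sum_range_mul_I_pow_div_factorial, Complex.exp_ofReal_mul_I_re, hn,
    Even.pow_abs ⟨M + 1, by ring⟩] at h'
  rw [abs_sub_comm] at h'
  refine le_of_eq_of_le ?_ (h'.trans_eq (by ring))
  congr 1
  ring

lemma intervalIntegrable_one_sub_mul_one_sub_cos_div_sq (a : ℝ) :
    IntervalIntegrable (fun x : ℝ => (1 - x) * (1 - Real.cos (a * x)) / x ^ 2) volume 0 1 := by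
  rw [intervalIntegrable_iff_integrableOn_Ioc_of_le zero_le_one]
  refine Measure.integrableOn_of_bounded (M := a ^ 2 / 2) (by simp)
    (by fun_prop : Measurable _).aestronglyMeasurable ?_
  refine (ae_restrict_iff' measurableSet_Ioc).2 (ae_of_all _ fun x hx => ?_)
  have hx2 : 0 < x ^ 2 := pow_pos hx.1 2
  have h1 : 0 ≤ 1 - Real.cos (a * x) := by linarith [Real.cos_le_one (a * x)]
  have h2 : 1 - Real.cos (a * x) ≤ (a * x) ^ 2 / 2 := by
    linarith [Real.one_sub_sq_div_two_le_cos (x := a * x)]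
  have h3 : 0 ≤ 1 - x := by linarith [hx.2]
  rw [Real.norm_of_nonneg (by positivity), div_le_iff₀ hx2]
  nlinarith [mul_nonneg hx.1.le h1]

lemma integral_one_sub_mul_pow (n : ℕ) :
    ∫ x in (0 : ℝ)..1, (1 - x) * x ^ n = 1 / ((n + 1) * (n + 2)) := by
  have h : ∀ x : ℝ, (1 - x) * x ^ n = x ^ n - x ^ (n + 1) := fun x => by ring
  simp_rw [h]
  rw [intervalIntegral.integral_sub (by simp) (by simp), integral_pow, integral_pow]
  have : (n : ℝ) + 1 ≠ 0 := by positivity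
  have : (n : ℝ) + 2 ≠ 0 := by positivity
  have : (n : ℝ) + 1 + 1 ≠ 0 := by positivity
  push_cast
  field_simp
  simp
  ring

/-- The Fejér-type cosine integral `∫₀¹ (1 - x) (1 - cos (a x)) / x² dx`. -/
noncomputable def fejerIntegral (a : ℝ) : ℝ :=
  ∫ x in (0 : ℝ)..1, (1 - x) * (1 - Real.cos (a * x)) / x ^ 2

/-- The coefficient of `± a ^ (2 * j + 2)` in the power series of `fejerIntegral a`. -/
noncomputable def fejerCoeff (j : ℕ) : ℝ :=
  1 / (((2 * j + 2).factorial : ℝ) * ((2 * j + 1) * (2 * j + 2)))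

lemma abs_fejerIntegral_sub_sum_le {a : ℝ} {M : ℕ} (ha : 0 ≤ a) (haM : a ≤ M) :
    |fejerIntegral a - ∑ j ∈ Finset.range M, (-1) ^ j * fejerCoeff j * a ^ (2 * j + 2)| ≤
      2 * fejerCoeff M * a ^ (2 * M + 2) := by
  have hterm : ∀ (c : ℝ) (j : ℕ),
      ∫ x in (0 : ℝ)..1, c * a ^ (2 * j + 2) / ((2 * j + 2).factorial : ℝ) *
        ((1 - x) * x ^ (2 * j)) = c * fejerCoeff j * a ^ (2 * j + 2) := fun c j => by
    rw [intervalIntegral.integral_const_mul, integral_one_sub_mul_pow, fejerCoeff]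
    push_cast
    field_simp
  have hsum : ∫ x in (0 : ℝ)..1, ∑ j ∈ Finset.range M,
      (-1) ^ j * a ^ (2 * j + 2) / ((2 * j + 2).factorial : ℝ) * ((1 - x) * x ^ (2 * j)) =
      ∑ j ∈ Finset.range M, (-1) ^ j * fejerCoeff j * a ^ (2 * j + 2) := by
    rw [intervalIntegral.integral_finsetSum fun j _ =>
      (by fun_prop : Continuous _).intervalIntegrable _ _]
    exact Finset.sum_congr rfl fun j _ => hterm _ j
  rw [← hsum, ← hterm 2 M, fejerIntegral, ← intervalIntegral.integral_sub
    (intervalIntegrable_one_sub_mul_one_sub_cos_div_sq a)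
    ((by fun_prop : Continuous _).intervalIntegrable _ _), ← Real.norm_eq_abs]
  refine intervalIntegral.norm_integral_le_of_norm_le zero_le_one (ae_of_all _ fun x hx => ?_)
    ((by fun_prop : Continuous _).intervalIntegrable _ _)
  have hx0 : x ≠ 0 := hx.1.ne'
  have hx1 : 0 ≤ 1 - x := by linarith [hx.2]
  have hax : |a * x| ≤ M := by
    rw [abs_of_nonneg (mul_nonneg ha hx.1.le)]
    nlinarith [hx.2]
  have key := mul_le_mul_of_nonneg_left (abs_one_sub_cos_sub_sum_le hax)
    (div_nonneg hx1 (sq_nonneg x))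
  rw [← abs_of_nonneg (div_nonneg hx1 (sq_nonneg x)), ← abs_mul,
    abs_of_nonneg (div_nonneg hx1 (sq_nonneg x))] at key
  rw [Real.norm_eq_abs]
  refine le_of_eq_of_le ?_ (key.trans_eq ?_)
  · rw [mul_sub ((1 - x) / x ^ 2), Finset.mul_sum]
    congr 2
    · ring
    · refine Finset.sum_congr rfl fun j _ => ?_
      rw [mul_pow, pow_add x]
      field_simp
  · rw [mul_pow, pow_add x]
    field_simp

lemma gfun_mul_cos_abs (τ t x : ℝ) :
    gfun τ |x| * Real.cos (2 * π * |x| * t) = gfun τ x * Real.cos (2 * π * x * t) := by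
  rcases abs_choice x with h | h
  · rw [h]
  · rw [h]
    simp [gfun]

lemma ghat_eq_intervalIntegral (τ t : ℝ) :
    ghat τ t = ∫ x in (0 : ℝ)..1, (1 - x) *
      (Real.cos (2 * π * τ * x) - Real.cos (2 * π * (τ + 1) * x)) *
        Real.cos (2 * π * x * t) / x ^ 2 / π ^ 2 := by
  have h := integral_comp_abs (f := fun x => gfun τ x * Real.cos (2 * π * x * t))
  simp only [gfun_mul_cos_abs] at h
  rw [ghat, h, intervalIntegral.integral_of_le zero_le_one,
    setIntegral_eq_of_subset_of_forall_sdiff_eq_zero measurableSet_Ioi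
      (s := Ioc (0 : ℝ) 1) Ioc_subset_Ioi_self, ← integral_const_mul]
  · refine setIntegral_congr_fun measurableSet_Ioc fun x hx => ?_
    have hx0 : x ≠ 0 := hx.1.ne'
    simp only [gfun, hx0, if_false, abs_of_pos hx.1, hx.2, if_true]
    field_simp
    ring
  · rintro x ⟨hx0, hx1⟩
    have hx : 1 < x := not_le.1 fun h => hx1 ⟨hx0, h⟩
    rw [mem_Ioi] at hx0
    simp [gfun, hx0.ne', abs_of_pos hx0, not_le.2 hx]

lemma ghat_zero_zero : ghat 0 0 = fejerIntegral (2 * π) / π ^ 2 := by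
  rw [ghat_eq_intervalIntegral, fejerIntegral, ← intervalIntegral.integral_div]
  simp

lemma ghat_one_one : ghat 1 1 =
    (fejerIntegral (2 * π) - fejerIntegral (4 * π) + fejerIntegral (6 * π)) / (2 * π ^ 2) := by
  have hI := intervalIntegrable_one_sub_mul_one_sub_cos_div_sq
  rw [ghat_eq_intervalIntegral, fejerIntegral, fejerIntegral, fejerIntegral,
    ← intervalIntegral.integral_sub (hI _) (hI _),
    ← intervalIntegral.integral_add ((hI _).sub (hI _)) (hI _), ← intervalIntegral.integral_div]
  congr 1
  ext x
  have h2 : Real.cos (4 * π * x) = 2 * Real.cos (2 * π * x) ^ 2 - 1 := by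
    rw [← Real.cos_two_mul]
    ring_nf
  have h3 : Real.cos (6 * π * x) = 4 * Real.cos (2 * π * x) ^ 3 - 3 * Real.cos (2 * π * x) := by
    rw [← Real.cos_three_mul]
    ring_nf
  rw [show 2 * π * (1 + 1) * x = 4 * π * x by ring, mul_one, mul_one, h2, h3]
  ring

lemma pi_sq_bounds : 9.8696044010 ≤ π ^ 2 ∧ π ^ 2 ≤ 9.8696044011 := by
  have h1 := Real.pi_gt_d20
  have h2 := Real.pi_lt_d20
  constructor <;> nlinarith

/-- A lower bound for an alternating polynomial in `π ^ 2` with nonnegative coefficients. -/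
lemma sum_alternating_pi_sq_ge {c : ℕ → ℝ} (hc : ∀ j, 0 ≤ c j) (M : ℕ) :
    ∑ j ∈ Finset.range M, (if Even j then c j * 9.8696044010 ^ j else -(c j * 9.8696044011 ^ j)) ≤
      ∑ j ∈ Finset.range M, (-1) ^ j * c j * (π ^ 2) ^ j := by
  refine Finset.sum_le_sum fun j _ => ?_
  split_ifs with hj
  · rw [hj.neg_one_pow, one_mul]
    exact mul_le_mul_of_nonneg_left (pow_le_pow_left₀ (by norm_num) pi_sq_bounds.1 j) (hc j)
  · rw [(Nat.not_even_iff_odd.1 hj).neg_one_pow, neg_one_mul, neg_mul, neg_le_neg_iff]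
    exact mul_le_mul_of_nonneg_left (pow_le_pow_left₀ (by positivity) pi_sq_bounds.2 j) (hc j)

lemma fejerCoeff_nonneg (j : ℕ) : 0 ≤ fejerCoeff j := by
  unfold fejerCoeff
  positivity

lemma two_mul_mul_pi_pow (k : ℝ) (j : ℕ) :
    (2 * k * π) ^ (2 * j + 2) = π ^ 2 * ((4 * k ^ 2) ^ (j + 1) * (π ^ 2) ^ j) := by
  rw [show 2 * j + 2 = 2 * (j + 1) by ring, pow_mul, mul_pow, mul_pow, pow_succ _ j, pow_succ _ j]
  ring

lemma abs_fejerIntegral_two_mul_mul_pi_div_sub_sum_le {k : ℝ} {M : ℕ} (hk : 0 ≤ k)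
    (hkM : 2 * k * π ≤ M) :
    |fejerIntegral (2 * k * π) / π ^ 2 -
        ∑ j ∈ Finset.range M, (-1) ^ j * (fejerCoeff j * (4 * k ^ 2) ^ (j + 1)) * (π ^ 2) ^ j| ≤
      2 * fejerCoeff M * (4 * k ^ 2) ^ (M + 1) * 9.8696044011 ^ M := by
  have hpi : 0 < π ^ 2 := by positivity
  have h := abs_fejerIntegral_sub_sum_le (by positivity) hkM
  have hs : ∑ j ∈ Finset.range M, (-1) ^ j * fejerCoeff j * (2 * k * π) ^ (2 * j + 2) =
      π ^ 2 * ∑ j ∈ Finset.range M,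
        (-1) ^ j * (fejerCoeff j * (4 * k ^ 2) ^ (j + 1)) * (π ^ 2) ^ j := by
    rw [Finset.mul_sum]
    refine Finset.sum_congr rfl fun j _ => ?_
    rw [two_mul_mul_pi_pow]
    ring
  rw [hs, two_mul_mul_pi_pow] at h
  have hM := pow_le_pow_left₀ hpi.le pi_sq_bounds.2 M
  have hc := fejerCoeff_nonneg M
  calc _ = |fejerIntegral (2 * k * π) - π ^ 2 * ∑ j ∈ Finset.range M,
        (-1) ^ j * (fejerCoeff j * (4 * k ^ 2) ^ (j + 1)) * (π ^ 2) ^ j| / π ^ 2 := by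
        rw [← abs_of_pos hpi, ← abs_div, abs_of_pos hpi, sub_div, mul_div_cancel_left₀ _ hpi.ne']
    _ ≤ 2 * fejerCoeff M * (4 * k ^ 2) ^ (M + 1) * (π ^ 2) ^ M := by
        rw [div_le_iff₀ hpi]
        exact h.trans_eq (by ring)
    _ ≤ _ := by gcongr

lemma ghat_zero_zero_gt : ghat 0 0 > 0.65 := by
  have h := (abs_le.1 (abs_fejerIntegral_two_mul_mul_pi_div_sub_sum_le (k := 1) (M := 12)
    (by norm_num) (by norm_num; linarith [Real.pi_lt_d2]))).1
  have hs := sum_alternating_pi_sq_ge (c := fun j => fejerCoeff j * (4 * 1 ^ 2) ^ (j + 1))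
    (fun j => mul_nonneg (fejerCoeff_nonneg j) (by positivity)) 12
  have hn : (0.65 : ℝ) + 2 * fejerCoeff 12 * (4 * 1 ^ 2) ^ (12 + 1) * 9.8696044011 ^ 12 <
      ∑ j ∈ Finset.range 12, (if Even j then fejerCoeff j * (4 * 1 ^ 2) ^ (j + 1) * 9.8696044010 ^ j
        else -(fejerCoeff j * (4 * 1 ^ 2) ^ (j + 1) * 9.8696044011 ^ j)) := by
    norm_num [Finset.sum_range_succ, fejerCoeff, Nat.factorial, Nat.even_iff]
  rw [ghat_zero_zero]
  rw [mul_one] at h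
  linarith

lemma ghat_one_one_gt : ghat 1 1 > 0.8 := by
  have hpi := Real.pi_lt_d2
  have h1 := (abs_le.1 (abs_fejerIntegral_two_mul_mul_pi_div_sub_sum_le (k := 1) (M := 32)
    (by norm_num) (by norm_num; linarith))).1
  have h2 := (abs_le.1 (abs_fejerIntegral_two_mul_mul_pi_div_sub_sum_le (k := 2) (M := 32)
    (by norm_num) (by norm_num; linarith))).2
  have h3 := (abs_le.1 (abs_fejerIntegral_two_mul_mul_pi_div_sub_sum_le (k := 3) (M := 32)
    (by norm_num) (by norm_num; linarith))).1
  have hc : ∀ j : ℕ, (0 : ℝ) ≤ (4 * 1 ^ 2) ^ (j + 1) - (4 * 2 ^ 2) ^ (j + 1)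
      + (4 * 3 ^ 2) ^ (j + 1) := fun j => by
    have : ((4 : ℝ) * 2 ^ 2) ^ (j + 1) ≤ (4 * 3 ^ 2) ^ (j + 1) :=
      pow_le_pow_left₀ (by norm_num) (by norm_num) _
    have : (0 : ℝ) ≤ (4 * 1 ^ 2) ^ (j + 1) := by positivity
    linarith
  have hs := sum_alternating_pi_sq_ge
    (c := fun j => fejerCoeff j * ((4 * 1 ^ 2) ^ (j + 1) - (4 * 2 ^ 2) ^ (j + 1)
      + (4 * 3 ^ 2) ^ (j + 1))) (fun j => mul_nonneg (fejerCoeff_nonneg j) (hc j)) 32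
  have hsplit : ∑ j ∈ Finset.range 32, (-1) ^ j * (fejerCoeff j * ((4 * 1 ^ 2) ^ (j + 1)
        - (4 * 2 ^ 2) ^ (j + 1) + (4 * 3 ^ 2) ^ (j + 1))) * (π ^ 2) ^ j =
      ∑ j ∈ Finset.range 32, (-1) ^ j * (fejerCoeff j * (4 * 1 ^ 2) ^ (j + 1)) * (π ^ 2) ^ j -
      ∑ j ∈ Finset.range 32, (-1) ^ j * (fejerCoeff j * (4 * 2 ^ 2) ^ (j + 1)) * (π ^ 2) ^ j +
      ∑ j ∈ Finset.range 32, (-1) ^ j * (fejerCoeff j * (4 * 3 ^ 2) ^ (j + 1)) * (π ^ 2) ^ j := by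
    rw [← Finset.sum_sub_distrib, ← Finset.sum_add_distrib]
    exact Finset.sum_congr rfl fun j _ => by ring
  have hn : (1.6 : ℝ) + (2 * fejerCoeff 32 * (4 * 1 ^ 2) ^ (32 + 1) * 9.8696044011 ^ 32 +
        2 * fejerCoeff 32 * (4 * 2 ^ 2) ^ (32 + 1) * 9.8696044011 ^ 32 +
        2 * fejerCoeff 32 * (4 * 3 ^ 2) ^ (32 + 1) * 9.8696044011 ^ 32) <
      ∑ j ∈ Finset.range 32, (if Even j then fejerCoeff j * ((4 * 1 ^ 2) ^ (j + 1)
          - (4 * 2 ^ 2) ^ (j + 1) + (4 * 3 ^ 2) ^ (j + 1)) * 9.8696044010 ^ j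
        else -(fejerCoeff j * ((4 * 1 ^ 2) ^ (j + 1)
          - (4 * 2 ^ 2) ^ (j + 1) + (4 * 3 ^ 2) ^ (j + 1)) * 9.8696044011 ^ j)) := by
    norm_num [Finset.sum_range_succ, fejerCoeff, Nat.factorial, Nat.even_iff]
  rw [hsplit] at hs
  have hg : ghat 1 1 = (fejerIntegral (2 * 1 * π) / π ^ 2 - fejerIntegral (2 * 2 * π) / π ^ 2 +
      fejerIntegral (2 * 3 * π) / π ^ 2) / 2 := by
    rw [ghat_one_one]
    norm_num
    ring
  rw [hg]
  linarith

theorem ghat_numerical_bounds : ghat 0 0 > 0.65 ∧ ghat 1 1 > 0.8 :=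
  ⟨ghat_zero_zero_gt, ghat_one_one_gt⟩
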